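/- Fix integers n > m ≥ 0, μ = n − m, and complex numbers α_1,…,α_n and β_1,…,β_m. On the polynomial ring ℂ[X] let D denote the formal-derivative linear map and T the multiplication-by-X linear map. Then the following identity of ℂ-linear endomorphisms of ℂ[X] holds: ∏_{i=1}^n ( (1/μ)·(−(D∘T)) − α_i ) − (−D)^μ ∘ ∏_{j=1}^m ( (1/μ)·(−(D∘T)) − β_j ) = (−1)^n · ( ∏_{i=1}^n ( (1/μ)·(T∘D) + α_i + 1/μ ) − D^μ ∘ ∏_{j=1}^m ( (1/μ)·(T∘D) + β_j + 1/μ ) ), where the products are compositions of the (pairwise commuting) factors. -/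

import Mathlib

open Polynomial

theorem List.prod_ofFn_neg {R : Type*} [Ring R] {n : ℕ} (f : Fin n → R) :
    (List.ofFn fun i => -f i).prod = (-1) ^ n * (List.ofFn f).prod := by
  induction n with
  | zero => simp
  | succ n ih =>
    rw [List.ofFn_succ, List.ofFn_succ, List.prod_cons, List.prod_cons, ih, pow_succ, mul_assoc,
      neg_one_mul, ← neg_mul, ← mul_assoc, ← mul_assoc,
      ((Commute.neg_one_left (-f 0)).pow_left n).eq]

/-- Fourier transform computation of Section 2: with `D` the formal derivative
and `T` multiplication by `X` on `ℂ[X]`,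
`∏ᵢ((1/μ)(−D∘T) − αᵢ) − (−D)^μ ∘ ∏ⱼ((1/μ)(−D∘T) − βⱼ)
  = (−1)^n · (∏ᵢ((1/μ)(T∘D) + αᵢ + 1/μ) − D^μ ∘ ∏ⱼ((1/μ)(T∘D) + βⱼ + 1/μ))`. -/
theorem fourier_transform_hypergeometric
    (n m : ℕ) (hnm : m < n) (μ : ℕ) (hμ : μ = n - m)
    (α : Fin n → ℂ) (β : Fin m → ℂ)
    (D T : Module.End ℂ ℂ[X])
    (hD : ∀ f : ℂ[X], D f = derivative f)
    (hT : ∀ f : ℂ[X], T f = X * f) :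
    (List.ofFn fun i : Fin n =>
        (1 / (μ : ℂ)) • (-(D * T)) - algebraMap ℂ (Module.End ℂ ℂ[X]) (α i)).prod
      - (-D) ^ μ *
        (List.ofFn fun j : Fin m =>
          (1 / (μ : ℂ)) • (-(D * T)) - algebraMap ℂ (Module.End ℂ ℂ[X]) (β j)).prod
    = (-1 : ℂ) ^ n •
      ((List.ofFn fun i : Fin n =>
          (1 / (μ : ℂ)) • (T * D)
            + algebraMap ℂ (Module.End ℂ ℂ[X]) (α i + 1 / (μ : ℂ))).prod
        - D ^ μ *
          (List.ofFn fun j : Fin m =>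
            (1 / (μ : ℂ)) • (T * D)
              + algebraMap ℂ (Module.End ℂ ℂ[X]) (β j + 1 / (μ : ℂ))).prod) := by
  have hDT : D * T = T * D + 1 := by
    refine LinearMap.ext fun f => ?_
    simp [hD, hT, add_comm]
  have factor (c : ℂ) : (1 / (μ : ℂ)) • (-(D * T)) - algebraMap ℂ (Module.End ℂ ℂ[X]) c
      = -((1 / (μ : ℂ)) • (T * D) + algebraMap ℂ (Module.End ℂ ℂ[X]) (c + 1 / (μ : ℂ))) := by
    rw [hDT, map_add, Algebra.algebraMap_eq_smul_one (1 / (μ : ℂ)), smul_neg, smul_add]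
    abel
  have sign (A : Module.End ℂ ℂ[X]) (k : ℕ) : (-1) ^ k * A = (-1 : ℂ) ^ k • A := by
    rw [Algebra.smul_def, map_pow, map_neg, map_one]
  have hn : n = μ + m := by omega
  simp only [factor, List.prod_ofFn_neg]
  rw [neg_pow D, mul_assoc, sign, sign, sign, mul_smul_comm, smul_smul, ← pow_add, ← hn, smul_sub]
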